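/- arXiv:2305.03600 — 2 statements merged into one kernel-verified Lean document; each statement's English description precedes it below -/
import Mathlib

section
/- Let d be a real number with 0 ≤ d < 1/2. Then the iterated integral ∫₀¹∫₀^{y₁}∫₀^{y₂}∫₀^{y₃}∫₀^{y₄} (y₁−y₂)^(−d)(y₂−y₃)^(−d)(y₃−y₄)^(−d)(y₄−y₅)^(−d)(y₁−y₅)^(−d) dy₅ dy₄ dy₃ dy₂ dy₁ equals Γ(1−d)⁴·Γ(4−5d)/(Γ(4−4d)·Γ(6−5d)). -/
open Real

noncomputable def poch (a : ℝ) (k : ℕ) : ℝ := ∏ i ∈ Finset.range k, (a + i)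

noncomputable def F21 (a b c x : ℝ) : ℝ :=
  ∑' k : ℕ, poch a k * poch b k / (poch c k * (Nat.factorial k : ℝ)) * x ^ k

noncomputable def F32 (a b c e f : ℝ) : ℝ :=
  ∑' k : ℕ, poch a k * poch b k * poch c k / (poch e k * poch f k * (Nat.factorial k : ℝ))

noncomputable def F32x (a b c e f x : ℝ) : ℝ :=
  ∑' k : ℕ, poch a k * poch b k * poch c k / (poch e k * poch f k * (Nat.factorial k : ℝ)) * x ^ k

noncomputable def F43 (a b c g e f h : ℝ) : ℝ :=
  ∑' k : ℕ, poch a k * poch b k * poch c k * poch g k /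
    (poch e k * poch f k * poch h k * (Nat.factorial k : ℝ))

open MeasureTheory Set

noncomputable def KK (a x : ℝ) : ENNReal := if 0 < x then ENNReal.ofReal (x ^ (a - 1)) else 0

lemma KK_meas (a : ℝ) : Measurable (KK a) := by
  unfold KK
  apply Measurable.ite measurableSet_Ioi _ measurable_const
  fun_prop

lemma KK_meas' {α : Type*} [MeasurableSpace α] (a : ℝ) (f : α → ℝ) (hf : Measurable f) :
    Measurable (fun x => KK a (f x)) := (KK_meas a).comp hf

lemma beta_real (a b x : ℝ) (ha : 0 < a) (hb : 0 < b) (hx : 0 < x) :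
    ∫ y in (0:ℝ)..x, y ^ (b - 1) * (x - y) ^ (a - 1)
      = x ^ (a + b - 1) * (Gamma a * Gamma b / Gamma (a + b)) := by
  have h := Complex.betaIntegral_scaled b a hx
  rw [Complex.betaIntegral_eq_Gamma_mul_div _ _ (by simpa) (by simpa)] at h
  apply Complex.ofReal_injective
  rw [← intervalIntegral.integral_ofReal]
  have e : ∫ y in (0:ℝ)..x, ((y ^ (b - 1) * (x - y) ^ (a - 1) : ℝ) : ℂ)
      = ∫ y in (0:ℝ)..x, (y : ℂ) ^ ((b : ℂ) - 1) * ((x : ℂ) - y) ^ ((a : ℂ) - 1) := by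
    apply intervalIntegral.integral_congr
    intro y hy
    rw [uIcc_of_le hx.le] at hy
    simp only
    rw [Complex.ofReal_mul, Complex.ofReal_cpow hy.1, Complex.ofReal_cpow (by linarith [hy.2])]
    push_cast
    rfl
  rw [e, h]
  push_cast
  rw [Complex.ofReal_cpow hx.le, ← Complex.Gamma_ofReal, ← Complex.Gamma_ofReal,
    ← Complex.Gamma_ofReal]
  push_cast
  rw [add_comm (b : ℂ), mul_comm (Complex.Gamma b)]

noncomputable def BB (a b : ℝ) : ℝ := Gamma a * Gamma b / Gamma (a + b)

lemma BB_pos (a b : ℝ) (ha : 0 < a) (hb : 0 < b) : 0 < BB a b := by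
  have := Gamma_pos_of_pos ha
  have := Gamma_pos_of_pos hb
  have := Gamma_pos_of_pos (add_pos ha hb)
  unfold BB
  positivity

lemma conv0 (a b x : ℝ) (ha : 0 < a) (hb : 0 < b) :
    ∫⁻ y, KK a (x - y) * KK b y = ENNReal.ofReal (BB a b) * KK (a + b) x := by
  by_cases hx : 0 < x
  · have h := beta_real a b x ha hb hx
    have hp : 0 < x ^ (a + b - 1) * (Gamma a * Gamma b / Gamma (a + b)) :=
      mul_pos (rpow_pos_of_pos hx _) (BB_pos a b ha hb)
    rw [intervalIntegral.integral_of_le hx.le, integral_Ioc_eq_integral_Ioo] at h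
    have hi : IntegrableOn (fun y : ℝ => y ^ (b - 1) * (x - y) ^ (a - 1)) (Ioo 0 x) := by
      by_contra hc
      rw [integral_undef hc] at h
      linarith
    have h2 := ofReal_integral_eq_lintegral_ofReal hi (by
      filter_upwards [ae_restrict_mem measurableSet_Ioo] with y hy
      have := rpow_nonneg hy.1.le (b - 1)
      have := rpow_nonneg (sub_pos.2 hy.2).le (a - 1)
      simp only [Pi.zero_apply]
      positivity)
    rw [h] at h2
    rw [KK, if_pos hx, mul_comm (ENNReal.ofReal (BB a b)),
      ← ENNReal.ofReal_mul (rpow_nonneg hx.le _), BB, h2, ← lintegral_indicator measurableSet_Ioo]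
    congr 1
    ext y
    unfold KK
    by_cases h0 : 0 < y <;> by_cases h1 : y < x <;> simp [h0, h1]
    rw [mul_comm, ENNReal.ofReal_mul (rpow_nonneg h0.le _)]
  · rw [KK, if_neg hx, mul_zero, ← lintegral_zero (μ := volume) (α := ℝ)]
    congr 1
    ext y
    unfold KK
    split_ifs <;> first | (exfalso; linarith) | simp

lemma conv1 (a b x z : ℝ) (ha : 0 < a) (hb : 0 < b) :
    ∫⁻ y, KK a (x - y) * KK b (y - z) = ENNReal.ofReal (BB a b) * KK (a + b) (x - z) := by
  rw [← conv0 a b _ ha hb, ← lintegral_sub_right_eq_self (fun y => KK a (x - z - y) * KK b y) z]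
  congr 1
  ext y
  congr 2
  ring

lemma step (f : ℝ → ℝ) (L : ℝ → ENNReal) (hL : Measurable L) (a : ℝ) (ha : 0 < a)
    (h0 : ∀ x, x ∉ Ioo 0 a → L x = 0)
    (h : ∀ x ∈ Ioo 0 a, L x < ⊤ → f x = (L x).toReal) (hf : ∫⁻ x, L x < ⊤) :
    ∫ x in (0:ℝ)..a, f x = (∫⁻ x, L x).toReal := by
  have hae := ae_lt_top hL hf.ne
  rw [← integral_toReal hL.aemeasurable hae, intervalIntegral.integral_of_le ha.le,
    integral_Ioc_eq_integral_Ioo, ← integral_indicator measurableSet_Ioo]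
  apply integral_congr_ae
  filter_upwards [hae] with x hx
  by_cases hm : x ∈ Ioo 0 a
  · simp [hm, h x hm hx]
  · simp [hm, h0 x hm]

noncomputable def GG (d : ℝ) (y1 y2 y3 y4 y5 : ℝ) : ENNReal :=
  KK 1 (1 - y1) * KK (1-d) (y1 - y2) * KK (1-d) (y2 - y3) * KK (1-d) (y3 - y4)
    * KK (1-d) (y4 - y5) * KK (1-d) (y1 - y5) * KK 1 y5

lemma GG_zero (d y1 y2 y3 y4 y5 : ℝ)
    (h : ¬ (0 < y5 ∧ y5 < y4 ∧ y4 < y3 ∧ y3 < y2 ∧ y2 < y1 ∧ y1 < 1)) :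
    GG d y1 y2 y3 y4 y5 = 0 := by
  by_contra hc
  apply h
  unfold GG KK at hc
  simp only [mul_eq_zero, not_or, ite_eq_right_iff, Classical.not_imp] at hc
  obtain ⟨⟨⟨⟨⟨⟨⟨h1, -⟩, h2, -⟩, h3, -⟩, h4, -⟩, h5, -⟩, h6, -⟩, h7, -⟩ := hc
  refine ⟨?_, ?_, ?_, ?_, ?_, ?_⟩ <;> linarith

lemma GG_val (d y1 y2 y3 y4 y5 : ℝ)
    (h : (0 < y5 ∧ y5 < y4 ∧ y4 < y3 ∧ y3 < y2 ∧ y2 < y1 ∧ y1 < 1)) :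
    (y1 - y2) ^ (-d) * (y2 - y3) ^ (-d) * (y3 - y4) ^ (-d) * (y4 - y5) ^ (-d) * (y1 - y5) ^ (-d)
     = (GG d y1 y2 y3 y4 y5).toReal := by
  obtain ⟨h1, h2, h3, h4, h5, h6⟩ := h
  have e : 1 - d - 1 = -d := by ring
  have e12 : 0 < y1 - y2 := by linarith
  have e23 : 0 < y2 - y3 := by linarith
  have e34 : 0 < y3 - y4 := by linarith
  have e45 : 0 < y4 - y5 := by linarith
  have e15 : 0 < y1 - y5 := by linarith
  have e1 : 0 < 1 - y1 := by linarith
  simp only [GG, KK, if_pos e12, if_pos e23, if_pos e34, if_pos e45, if_pos e15, if_pos e1,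
    if_pos h1, e, ENNReal.toReal_mul]
  rw [ENNReal.toReal_ofReal (rpow_nonneg e12.le _), ENNReal.toReal_ofReal (rpow_nonneg e23.le _),
    ENNReal.toReal_ofReal (rpow_nonneg e34.le _), ENNReal.toReal_ofReal (rpow_nonneg e45.le _),
    ENNReal.toReal_ofReal (rpow_nonneg e15.le _)]
  simp

lemma GG_meas {α : Type*} [MeasurableSpace α] (d : ℝ) (f1 f2 f3 f4 f5 : α → ℝ)
    (h1 : Measurable f1) (h2 : Measurable f2) (h3 : Measurable f3) (h4 : Measurable f4)
    (h5 : Measurable f5) : Measurable (fun x => GG d (f1 x) (f2 x) (f3 x) (f4 x) (f5 x)) := by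
  unfold GG
  repeat' apply Measurable.mul
  all_goals (apply KK_meas'; fun_prop)

lemma L4_meas {α : Type*} [MeasurableSpace α] (d : ℝ) (f1 f2 f3 f4 : α → ℝ)
    (h1 : Measurable f1) (h2 : Measurable f2) (h3 : Measurable f3) (h4 : Measurable f4) :
    Measurable (fun x => ∫⁻ y5, GG d (f1 x) (f2 x) (f3 x) (f4 x) y5) :=
  Measurable.lintegral_prod_right' (f := fun q : α × ℝ => GG d (f1 q.1) (f2 q.1) (f3 q.1) (f4 q.1) q.2)
    (by apply GG_meas <;> fun_prop)

lemma L3_meas {α : Type*} [MeasurableSpace α] (d : ℝ) (f1 f2 f3 : α → ℝ)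
    (h1 : Measurable f1) (h2 : Measurable f2) (h3 : Measurable f3) :
    Measurable (fun x => ∫⁻ y4, ∫⁻ y5, GG d (f1 x) (f2 x) (f3 x) y4 y5) :=
  Measurable.lintegral_prod_right' (f := fun q : α × ℝ => ∫⁻ y5, GG d (f1 q.1) (f2 q.1) (f3 q.1) q.2 y5)
    (by apply L4_meas <;> fun_prop)

lemma L2_meas {α : Type*} [MeasurableSpace α] (d : ℝ) (f1 f2 : α → ℝ)
    (h1 : Measurable f1) (h2 : Measurable f2) :
    Measurable (fun x => ∫⁻ y3, ∫⁻ y4, ∫⁻ y5, GG d (f1 x) (f2 x) y3 y4 y5) :=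
  Measurable.lintegral_prod_right' (f := fun q : α × ℝ => ∫⁻ y4, ∫⁻ y5, GG d (f1 q.1) (f2 q.1) q.2 y4 y5)
    (by apply L3_meas <;> fun_prop)

lemma L1_meas {α : Type*} [MeasurableSpace α] (d : ℝ) (f1 : α → ℝ)
    (h1 : Measurable f1) :
    Measurable (fun x => ∫⁻ y2, ∫⁻ y3, ∫⁻ y4, ∫⁻ y5, GG d (f1 x) y2 y3 y4 y5) :=
  Measurable.lintegral_prod_right' (f := fun q : α × ℝ => ∫⁻ y3, ∫⁻ y4, ∫⁻ y5, GG d (f1 q.1) q.2 y3 y4 y5)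
    (by apply L2_meas <;> fun_prop)

lemma total (d : ℝ) (h1 : d < 1/2) :
    ∫⁻ y1, ∫⁻ y2, ∫⁻ y3, ∫⁻ y4, ∫⁻ y5, GG d y1 y2 y3 y4 y5 =
    ENNReal.ofReal (Gamma (1-d) ^ 4 * Gamma (4-5*d) / (Gamma (4-4*d) * Gamma (6-5*d))) := by
  have hd : 0 < 1 - d := by linarith
  have A4 : ∀ y1 y2 y3, ∫⁻ y4, ∫⁻ y5, GG d y1 y2 y3 y4 y5 = ∫⁻ y5,
      ENNReal.ofReal (BB (1-d) (1-d)) * (KK 1 (1 - y1) * KK (1-d) (y1 - y2) * KK (1-d) (y2 - y3)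
        * KK (1-d+(1-d)) (y3 - y5) * KK (1-d) (y1 - y5) * KK 1 y5) := by
    intro y1 y2 y3
    rw [lintegral_lintegral_swap (by
      apply Measurable.aemeasurable
      apply GG_meas <;> fun_prop)]
    congr 1
    ext y5
    calc _ = ∫⁻ y4, (KK 1 (1 - y1) * KK (1-d) (y1 - y2) * KK (1-d) (y2 - y3) * KK (1-d) (y1 - y5) * KK 1 y5)
          * (KK (1-d) (y3 - y4) * KK (1-d) (y4 - y5)) := by
          congr 1; ext y4; unfold GG; ring
      _ = _ := by
        rw [lintegral_const_mul, conv1 _ _ _ _ hd hd]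
        · ring
        · apply Measurable.mul <;> (apply KK_meas'; fun_prop)
  have A3 : ∀ y1 y2, ∫⁻ y3, ∫⁻ y4, ∫⁻ y5, GG d y1 y2 y3 y4 y5 = ∫⁻ y5,
      ENNReal.ofReal (BB (1-d) (1-d)) * ENNReal.ofReal (BB (1-d) (1-d+(1-d))) *
        (KK 1 (1 - y1) * KK (1-d) (y1 - y2)
        * KK (1-d+(1-d+(1-d))) (y2 - y5) * KK (1-d) (y1 - y5) * KK 1 y5) := by
    intro y1 y2
    simp_rw [A4]
    rw [lintegral_lintegral_swap (by
      apply Measurable.aemeasurable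
      apply Measurable.const_mul
      repeat' apply Measurable.mul
      all_goals (apply KK_meas'; fun_prop))]
    congr 1
    ext y5
    calc _ = ∫⁻ y3, (ENNReal.ofReal (BB (1-d) (1-d)) * KK 1 (1 - y1) * KK (1-d) (y1 - y2) * KK (1-d) (y1 - y5) * KK 1 y5)
          * (KK (1-d) (y2 - y3) * KK (1-d+(1-d)) (y3 - y5)) := by
          congr 1; ext y4; ring
      _ = _ := by
        rw [lintegral_const_mul, conv1 _ _ _ _ hd (by linarith)]
        · ring
        · apply Measurable.mul <;> (apply KK_meas'; fun_prop)
  have A2 : ∀ y1, ∫⁻ y2, ∫⁻ y3, ∫⁻ y4, ∫⁻ y5, GG d y1 y2 y3 y4 y5 =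
      ENNReal.ofReal (BB (1-d) (1-d)) * ENNReal.ofReal (BB (1-d) (1-d+(1-d))) *
      ENNReal.ofReal (BB (1-d) (1-d+(1-d+(1-d)))) *
      ENNReal.ofReal (BB (4-5*d) 1) * (KK 1 (1 - y1) * KK (4-5*d+1) (y1 - 0)) := by
    intro y1
    simp_rw [A3]
    rw [lintegral_lintegral_swap (by
      apply Measurable.aemeasurable
      apply Measurable.const_mul
      repeat' apply Measurable.mul
      all_goals (apply KK_meas'; fun_prop))]
    have B : ∀ y5, KK (1-d+(1-d+(1-d+(1-d)))) (y1 - y5) * KK (1-d) (y1 - y5) = KK (4-5*d) (y1 - y5) := by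
      intro y5
      unfold KK
      split_ifs with h
      · rw [← ENNReal.ofReal_mul (rpow_nonneg h.le _), ← rpow_add h]
        congr 2
        ring
      · simp
    calc _ = ∫⁻ y5, (ENNReal.ofReal (BB (1-d) (1-d)) * ENNReal.ofReal (BB (1-d) (1-d+(1-d))) *
            ENNReal.ofReal (BB (1-d) (1-d+(1-d+(1-d)))) * KK 1 (1 - y1)) *
            (KK (4-5*d) (y1 - y5) * KK 1 (y5 - 0)) := by
          congr 1
          ext y5
          calc _ = ∫⁻ y2, (ENNReal.ofReal (BB (1-d) (1-d)) * ENNReal.ofReal (BB (1-d) (1-d+(1-d))) * KK 1 (1 - y1) * KK (1-d) (y1 - y5) * KK 1 y5)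
                * (KK (1-d) (y1 - y2) * KK (1-d+(1-d+(1-d))) (y2 - y5)) := by
                congr 1; ext y4; ring
            _ = _ := by
              rw [lintegral_const_mul, conv1 _ _ _ _ hd (by linarith), ← B, sub_zero]
              · ring
              · apply Measurable.mul <;> (apply KK_meas'; fun_prop)
      _ = _ := by
        rw [lintegral_const_mul, conv1 _ _ _ _ (by linarith) one_pos]
        · ring
        · apply Measurable.mul <;> (apply KK_meas'; fun_prop)
  simp_rw [A2]
  rw [lintegral_const_mul _ (by apply Measurable.mul <;> (apply KK_meas'; fun_prop)),
    conv1 _ _ _ _ one_pos (by linarith)]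
  have K1 : KK (1 + (4 - 5*d+1)) (1 - 0) = 1 := by simp [KK]
  rw [K1, mul_one]
  have p1 := BB_pos (1-d) (1-d) hd hd
  have p2 := BB_pos (1-d) (1-d+(1-d)) hd (by linarith)
  have p3 := BB_pos (1-d) (1-d+(1-d+(1-d))) hd (by linarith)
  have p4 := BB_pos (4-5*d) 1 (by linarith) one_pos
  rw [← ENNReal.ofReal_mul (by positivity), ← ENNReal.ofReal_mul (by positivity),
    ← ENNReal.ofReal_mul (by positivity), ← ENNReal.ofReal_mul (by positivity)]
  congr 1
  unfold BB
  rw [show 1-d+(1-d+(1-d+(1-d))) = 4-4*d by ring, show 1 + (4-5*d+1) = 6-5*d by ring, Gamma_one]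
  have g2 := (Gamma_pos_of_pos (show 0 < 1-d+(1-d) by linarith)).ne'
  have g3 := (Gamma_pos_of_pos (show 0 < 1-d+(1-d+(1-d)) by linarith)).ne'
  have g5 := (Gamma_pos_of_pos (show 0 < 4-5*d+1 by linarith)).ne'
  have g4 := (Gamma_pos_of_pos (show 0 < 4-4*d by linarith)).ne'
  have g6 := (Gamma_pos_of_pos (show 0 < 6-5*d by linarith)).ne'
  generalize Gamma (1-d+(1-d)) = G2 at *
  generalize Gamma (1-d+(1-d+(1-d))) = G3 at *
  generalize Gamma (4-5*d+1) = G5 at *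
  generalize Gamma (4-4*d) = G4 at *
  generalize Gamma (6-5*d) = G6 at *
  field_simp

theorem stmt6 (d : ℝ) (h0 : 0 ≤ d) (h1 : d < 1/2) :
    (∫ y1 in (0:ℝ)..1, ∫ y2 in (0:ℝ)..y1, ∫ y3 in (0:ℝ)..y2, ∫ y4 in (0:ℝ)..y3, ∫ y5 in (0:ℝ)..y4,
      (y1 - y2) ^ (-d) * (y2 - y3) ^ (-d) * (y3 - y4) ^ (-d) * (y4 - y5) ^ (-d) * (y1 - y5) ^ (-d)) =
    Gamma (1-d) ^ 4 * Gamma (4-5*d) / (Gamma (4-4*d) * Gamma (6-5*d)) := by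
  have ht := total d h1
  have hfin : ∫⁻ y1, ∫⁻ y2, ∫⁻ y3, ∫⁻ y4, ∫⁻ y5, GG d y1 y2 y3 y4 y5 < ⊤ := by
    rw [ht]; exact ENNReal.ofReal_lt_top
  have hnn : 0 ≤ Gamma (1-d) ^ 4 * Gamma (4-5*d) / (Gamma (4-4*d) * Gamma (6-5*d)) := by
    have := Gamma_pos_of_pos (show 0 < 1-d by linarith)
    have := Gamma_pos_of_pos (show 0 < 4-5*d by linarith)
    have := Gamma_pos_of_pos (show 0 < 4-4*d by linarith)
    have := Gamma_pos_of_pos (show 0 < 6-5*d by linarith)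
    positivity
  rw [← ENNReal.toReal_ofReal hnn, ← ht]
  have Z4 : ∀ y1 y2 y3 y4, ¬ (0 < y4 ∧ y4 < y3 ∧ y3 < y2 ∧ y2 < y1 ∧ y1 < 1) →
      ∫⁻ y5, GG d y1 y2 y3 y4 y5 = 0 := by
    intro y1 y2 y3 y4 h
    rw [lintegral_congr (g := fun _ => 0), lintegral_zero]
    intro y5
    apply GG_zero
    contrapose! h
    refine ⟨?_, ?_, ?_, ?_, ?_⟩ <;> linarith [h.1, h.2.1, h.2.2.1, h.2.2.2.1, h.2.2.2.2.1, h.2.2.2.2.2]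
  have Z3 : ∀ y1 y2 y3, ¬ (0 < y3 ∧ y3 < y2 ∧ y2 < y1 ∧ y1 < 1) →
      ∫⁻ y4, ∫⁻ y5, GG d y1 y2 y3 y4 y5 = 0 := by
    intro y1 y2 y3 h
    rw [lintegral_congr (g := fun _ => 0), lintegral_zero]
    intro y4
    apply Z4
    contrapose! h
    refine ⟨?_, ?_, ?_, ?_⟩ <;> linarith [h.1, h.2.1, h.2.2.1, h.2.2.2.1, h.2.2.2.2]
  have Z2 : ∀ y1 y2, ¬ (0 < y2 ∧ y2 < y1 ∧ y1 < 1) →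
      ∫⁻ y3, ∫⁻ y4, ∫⁻ y5, GG d y1 y2 y3 y4 y5 = 0 := by
    intro y1 y2 h
    rw [lintegral_congr (g := fun _ => 0), lintegral_zero]
    intro y3
    apply Z3
    contrapose! h
    refine ⟨?_, ?_, ?_⟩ <;> linarith [h.1, h.2.1, h.2.2.1, h.2.2.2]
  have Z1 : ∀ y1, ¬ (0 < y1 ∧ y1 < 1) →
      ∫⁻ y2, ∫⁻ y3, ∫⁻ y4, ∫⁻ y5, GG d y1 y2 y3 y4 y5 = 0 := by
    intro y1 h
    rw [lintegral_congr (g := fun _ => 0), lintegral_zero]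
    intro y2
    apply Z2
    contrapose! h
    refine ⟨?_, ?_⟩ <;> linarith [h.1, h.2.1, h.2.2]
  refine step _ _ (L1_meas d _ measurable_id) 1 one_pos (fun x hx => Z1 x hx) ?_ hfin
  intro y1 m1 f1
  refine step _ _ (L2_meas d _ _ measurable_const measurable_id) y1 m1.1
    (fun x hx => Z2 _ x fun h => hx ⟨h.1, h.2.1⟩) ?_ f1
  intro y2 m2 f2
  refine step _ _ (L3_meas d _ _ _ measurable_const measurable_const measurable_id) y2 m2.1
    (fun x hx => Z3 _ _ x fun h => hx ⟨h.1, h.2.1⟩) ?_ f2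
  intro y3 m3 f3
  refine step _ _ (L4_meas d _ _ _ _ measurable_const measurable_const measurable_const
    measurable_id) y3 m3.1
    (fun x hx => Z4 _ _ _ x fun h => hx ⟨h.1, h.2.1⟩) ?_ f3
  intro y4 m4 f4
  refine step _ _ (GG_meas d _ _ _ _ _ measurable_const measurable_const measurable_const
    measurable_const measurable_id) y4 m4.1
    (fun x hx => GG_zero _ _ _ _ _ x fun h => hx ⟨h.1, h.2.1⟩) ?_ f4
  intro y5 m5 _
  exact GG_val d y1 y2 y3 y4 y5 ⟨m5.1, m5.2, m4.2, m3.2, m2.2, m1.2⟩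
end

section
/- Let d be a real number with 0 ≤ d < 1/2. Then the iterated integral ∫₀¹∫₀^{y₁}∫₀^{y₂}∫₀^{y₃}∫₀^{y₄} (y₁−y₂)^(−d)(y₂−y₄)^(−d)(y₃−y₄)^(−d)(y₃−y₅)^(−d)(y₁−y₅)^(−d) dy₅ dy₄ dy₃ dy₂ dy₁ equals (Γ(1−d)/(2(1−d)²))·(Γ(3−3d)·Γ(4−5d)/(Γ(4−4d)·Γ(6−5d)))·₃F₂(1, d, 2−2d; 2−d, 3−2d; 1). -/
open Real

open MeasureTheory Set ProbabilityTheory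

lemma aff (c b : ℝ) (h : c < b) (Φ : ℝ → ENNReal) :
    ∫⁻ y in Ioo c b, Φ y = ENNReal.ofReal (b - c) * ∫⁻ t in Ioo (0:ℝ) 1, Φ (c + (b - c) * t) := by
  have hbc : 0 < b - c := by linarith
  have him : (fun t : ℝ => c + (b - c) * t) '' Ioo (0:ℝ) 1 = Ioo c b := by
    ext y
    constructor
    · rintro ⟨t, ⟨h1, h2⟩, rfl⟩
      constructor <;> simp only <;> nlinarith
    · rintro ⟨h1, h2⟩
      refine ⟨(y - c) / (b - c), ⟨by apply div_pos <;> linarith, ?_⟩, ?_⟩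
      · rw [div_lt_one hbc]; linarith
      · simp only; field_simp; ring
  rw [← him, lintegral_image_eq_lintegral_abs_deriv_mul measurableSet_Ioo
    (f' := fun _ => b - c)]
  · rw [abs_of_pos hbc, lintegral_const_mul' _ _ ENNReal.ofReal_ne_top]
  · intro x _
    have := (((hasDerivAt_id x).const_mul (b - c)).const_add c).hasDerivWithinAt (s := Ioo 0 1)
    simpa using this
  · intro x _ y _ hxy
    simp only at hxy
    have : (b - c) * x = (b - c) * y := by linarith
    exact mul_left_cancel₀ hbc.ne' this

lemma betaL (a b : ℝ) (ha : -1 < a) (hb : -1 < b) :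
    ∫⁻ x in Ioo (0:ℝ) 1, ENNReal.ofReal (x ^ a * (1 - x) ^ b)
      = ENNReal.ofReal (beta (a + 1) (b + 1)) := by
  have h := lintegral_betaPDF_eq_one (α := a + 1) (β := b + 1) (by linarith) (by linarith)
  have hp := beta_pos (α := a + 1) (β := b + 1) (by linarith) (by linarith)
  rw [lintegral_betaPDF] at h
  simp only [add_sub_cancel_right, mul_assoc] at h
  simp_rw [ENNReal.ofReal_mul (one_div_pos.2 hp).le] at h
  rw [lintegral_const_mul' _ _ ENNReal.ofReal_ne_top] at h
  calc _ = ENNReal.ofReal (beta (a + 1) (b + 1)) * (ENNReal.ofReal (1 / beta (a + 1) (b + 1)) *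
        ∫⁻ x in Ioo (0:ℝ) 1, ENNReal.ofReal (x ^ a * (1 - x) ^ b)) := by
        rw [← mul_assoc, ← ENNReal.ofReal_mul hp.le, mul_one_div_cancel hp.ne']; simp
    _ = _ := by rw [h, mul_one]

lemma beta_one' (s : ℝ) (hs : 0 < s) : beta s 1 = 1 / s := by
  have := Gamma_pos_of_pos hs
  rw [beta, Gamma_add_one hs.ne', Gamma_one]; field_simp

lemma beta_comm' (s t : ℝ) : beta s t = beta t s := by
  rw [beta, beta, add_comm, mul_comm (Gamma s)]

lemma powL (a : ℝ) (ha : -1 < a) :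
    ∫⁻ x in Ioo (0:ℝ) 1, ENNReal.ofReal (x ^ a) = ENNReal.ofReal (1 / (a + 1)) := by
  have := betaL a 0 ha (by norm_num)
  simpa [beta_one' (a + 1) (by linarith)] using this

lemma powL' (a : ℝ) (ha : -1 < a) :
    ∫⁻ x in Ioo (0:ℝ) 1, ENNReal.ofReal ((1 - x) ^ a) = ENNReal.ofReal (1 / (a + 1)) := by
  have := betaL 0 a (by norm_num) ha
  rw [beta_comm'] at this
  simpa [beta_one' (a + 1) (by linarith)] using this

lemma meas_Ioo {α : Type*} [MeasurableSpace α] (a b : α → ℝ) (ha : Measurable a) (hb : Measurable b)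
    (Φ : α → ℝ → ENNReal) (hΦ : Measurable (fun p : α × ℝ => Φ p.1 p.2)) :
    Measurable (fun x => ∫⁻ y in Ioo (a x) (b x), Φ x y) := by
  have : (fun x => ∫⁻ y in Ioo (a x) (b x), Φ x y)
      = fun x => ∫⁻ y, (if a x < y ∧ y < b x then Φ x y else 0) := by
    ext x
    rw [← lintegral_indicator measurableSet_Ioo]
    congr 1; ext y
    simp only [indicator, mem_Ioo]
  rw [this]
  refine Measurable.lintegral_prod_right (f := fun x y => if a x < y ∧ y < b x then Φ x y else 0) ?_
  refine Measurable.ite ?_ hΦ measurable_const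
  exact (measurableSet_lt (ha.comp measurable_fst) measurable_snd).inter
    (measurableSet_lt measurable_snd (hb.comp measurable_fst))

lemma tri (b : ℝ) (Φ : ℝ → ℝ → ENNReal) (hΦ : Measurable (fun p : ℝ × ℝ => Φ p.1 p.2)) :
    ∫⁻ x in Ioo 0 b, ∫⁻ y in Ioo 0 x, Φ x y = ∫⁻ y in Ioo 0 b, ∫⁻ x in Ioo y b, Φ x y := by
  have e1 : ∫⁻ x in Ioo 0 b, ∫⁻ y in Ioo 0 x, Φ x y
      = ∫⁻ x, ∫⁻ y, (if 0 < y ∧ y < x ∧ x < b then Φ x y else 0) := by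
    rw [← lintegral_indicator measurableSet_Ioo]
    congr 1; ext x
    by_cases hx : x ∈ Ioo 0 b
    · rw [indicator_of_mem hx, ← lintegral_indicator measurableSet_Ioo]
      congr 1; ext y
      simp only [indicator, mem_Ioo, hx.2, and_true]
    · rw [indicator_of_notMem hx]
      symm
      convert lintegral_zero with y
      rw [if_neg]
      rintro ⟨h1, h2, h3⟩
      exact hx ⟨h1.trans h2, h3⟩
  have e2 : ∫⁻ y in Ioo 0 b, ∫⁻ x in Ioo y b, Φ x y
      = ∫⁻ y, ∫⁻ x, (if 0 < y ∧ y < x ∧ x < b then Φ x y else 0) := by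
    rw [← lintegral_indicator measurableSet_Ioo]
    congr 1; ext x
    by_cases hx : x ∈ Ioo 0 b
    · rw [indicator_of_mem hx, ← lintegral_indicator measurableSet_Ioo]
      congr 1; ext y
      simp only [indicator, mem_Ioo, hx.1, true_and]
    · rw [indicator_of_notMem hx]
      symm
      convert lintegral_zero with y
      rw [if_neg]
      rintro ⟨h1, h2, h3⟩
      exact hx ⟨h1, h2.trans h3⟩
  rw [e1, e2]
  apply lintegral_lintegral_swap
  apply Measurable.aemeasurable
  refine Measurable.ite ?_ hΦ measurable_const
  exact (measurableSet_lt measurable_const measurable_snd).inter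
    ((measurableSet_lt measurable_snd measurable_fst).inter
      (measurableSet_lt measurable_fst measurable_const))

lemma stepL (b : ℝ) (hb : 0 ≤ b) (H : ℝ → ENNReal) (hH : Measurable H) (g : ℝ → ℝ)
    (hfin : ∫⁻ y in Ioo 0 b, H y ≠ ⊤)
    (hg : ∀ y ∈ Ioo 0 b, H y ≠ ⊤ → g y = (H y).toReal) :
    ∫ y in (0:ℝ)..b, g y = (∫⁻ y in Ioo 0 b, H y).toReal := by
  have hae := ae_lt_top hH hfin
  rw [intervalIntegral.integral_of_le hb, integral_Ioc_eq_integral_Ioo,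
    ← integral_toReal hH.aemeasurable hae]
  apply integral_congr_ae
  filter_upwards [hae, ae_restrict_mem measurableSet_Ioo] with y h1 h2
  exact hg y h2 h1.ne

lemma poch_succ (a : ℝ) (k : ℕ) : poch a (k + 1) = poch a k * (a + k) := by
  simp [poch, Finset.prod_range_succ]

lemma poch_pos (a : ℝ) (ha : 0 < a) (k : ℕ) : 0 < poch a k :=
  Finset.prod_pos (fun i _ => by positivity)

lemma poch_nonneg (a : ℝ) (ha : 0 ≤ a) (k : ℕ) : 0 ≤ poch a k :=
  Finset.prod_nonneg (fun i _ => by positivity)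

lemma poch_zero' (a : ℝ) : poch a 0 = 1 := by simp [poch]

lemma poch_one' (k : ℕ) : poch 1 k = (Nat.factorial k : ℝ) := by
  induction k with
  | zero => simp [poch]
  | succ n ih => rw [poch_succ, ih, Nat.factorial_succ]; push_cast; ring

lemma poch_shift (a : ℝ) (ha : 0 < a) (k : ℕ) : poch a k / poch (a + 1) k = a / (a + k) := by
  induction k with
  | zero => simp [poch, ha.ne']
  | succ n ih =>
    have := poch_pos (a + 1) (by linarith) n
    rw [poch_succ, poch_succ, mul_div_mul_comm, ih]; push_cast; field_simp; ring

lemma asc_poch (a : ℝ) (k : ℕ) : (ascPochhammer ℕ k).smeval a = poch a k := by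
  rw [Polynomial.ascPochhammer_smeval_eq_eval]
  induction k with
  | zero => simp [poch]
  | succ n ih => rw [ascPochhammer_succ_eval, ih, poch_succ]

lemma choose_poch (a : ℝ) (k : ℕ) :
    Ring.choose (a + k - 1) k = poch a k / (Nat.factorial k : ℝ) := by
  have h := Ring.factorial_nsmul_multichoose_eq_ascPochhammer a k
  rw [Ring.multichoose_eq, nsmul_eq_mul] at h
  rw [← asc_poch, ← h]; field_simp

lemma binom (a x : ℝ) (hx0 : 0 ≤ x) (hx : x < 1) :
    HasSum (fun k : ℕ => poch a k / (Nat.factorial k : ℝ) * x ^ k) ((1 - x) ^ (-a)) := by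
  have h := (Real.one_div_one_sub_rpow_hasFPowerSeriesOnBall_zero a).hasSum (y := x) (by
    simp [enorm_eq_nnnorm, ← NNReal.coe_lt_coe, abs_of_nonneg hx0, hx])
  simp only [zero_add] at h
  rw [rpow_neg (by linarith), ← one_div]
  have e : (fun k : ℕ => poch a k / (Nat.factorial k : ℝ) * x ^ k) = fun n : ℕ =>
      (FormalMultilinearSeries.ofScalars ℝ (fun n : ℕ => Ring.choose (a + n - 1) n) n)
        fun _ => x := by
    ext k
    simp [choose_poch, FormalMultilinearSeries.ofScalars]
  rw [e]; exact h

lemma beta_poch (s : ℝ) (hs : 0 < s) (k : ℕ) :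
    beta (k + 1) s = (Nat.factorial k : ℝ) / (s * poch (s + 1) k) := by
  rw [beta, Gamma_nat_eq_factorial]
  have : Gamma (k + 1 + s) = s * poch (s + 1) k * Gamma s := by
    induction k with
    | zero => simp [poch, add_comm, Gamma_add_one hs.ne']
    | succ n ih =>
      push_cast
      rw [show (n:ℝ) + 1 + 1 + s = (n + 1 + s) + 1 by ring, Gamma_add_one (by positivity), ih,
        poch_succ]; ring
  rw [this]
  have := poch_pos (s + 1) (by linarith) k
  have := Gamma_pos_of_pos hs
  field_simp

lemma poch_le (d : ℝ) (h0 : 0 ≤ d) (h1 : d < 1/2) (k : ℕ) :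
    poch d k * (k + 1) ≤ poch (2 - d) k := by
  induction k with
  | zero => simp [poch]
  | succ n ih =>
    rw [poch_succ, poch_succ]
    have hp := poch_nonneg d h0 n
    have hn : (0:ℝ) ≤ n := n.cast_nonneg
    have e1 : (d + n) * (n + 2) ≤ (n + 1) * (2 - d + n) := by nlinarith
    calc poch d n * (d + n) * ((n + 1 : ℕ) + 1) = poch d n * ((d + n) * (n + 2)) := by
          push_cast; ring
      _ ≤ poch d n * ((n + 1) * (2 - d + n)) := by gcongr
      _ = poch d n * (n + 1) * (2 - d + n) := by ring
      _ ≤ _ := by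
        apply mul_le_mul_of_nonneg_right ih; linarith

noncomputable def tm (d : ℝ) (k : ℕ) : ℝ :=
  poch 1 k * poch d k * poch (2-2*d) k / (poch (2-d) k * poch (3-2*d) k * (Nat.factorial k : ℝ))

lemma tm_eq (d : ℝ) (h0 : 0 ≤ d) (h1 : d < 1/2) (k : ℕ) :
    tm d k = poch d k / poch (2 - d) k * ((2 - 2 * d) / (2 - 2 * d + k)) := by
  rw [tm, poch_one', ← poch_shift (2 - 2 * d) (by linarith) k]
  rw [show 2 - 2 * d + 1 = 3 - 2 * d by ring]
  have := poch_pos (2 - d) (by linarith) k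
  have := poch_pos (3 - 2 * d) (by linarith) k
  have : (0:ℝ) < Nat.factorial k := by positivity
  field_simp

lemma tm_nonneg (d : ℝ) (h0 : 0 ≤ d) (h1 : d < 1/2) (k : ℕ) : 0 ≤ tm d k := by
  rw [tm_eq d h0 h1]
  have := poch_pos (2 - d) (by linarith) k
  have := poch_nonneg d h0 k
  have : (0:ℝ) < 2 - 2 * d := by linarith
  positivity

lemma tm_summable (d : ℝ) (h0 : 0 ≤ d) (h1 : d < 1/2) : Summable (tm d) := by
  have hs : Summable (fun k : ℕ => 2 * (1 / ((k + 1 : ℕ) : ℝ) ^ 2)) :=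
    ((summable_nat_add_iff 1).2 (Real.summable_one_div_nat_pow.2 (by norm_num : 1 < 2))).mul_left 2
  refine Summable.of_nonneg_of_le (tm_nonneg d h0 h1) (fun k => ?_) hs
  rw [tm_eq d h0 h1]
  have hp := poch_pos (2 - d) (by linarith) k
  have hk : (0:ℝ) ≤ k := k.cast_nonneg
  have a1 : poch d k / poch (2 - d) k ≤ 1 / (k + 1) := by
    rw [div_le_div_iff₀ hp (by positivity)]
    have := poch_le d h0 h1 k
    linarith
  have a2 : (2 - 2 * d) / (2 - 2 * d + k) ≤ 2 / (k + 1) := by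
    rw [div_le_div_iff₀ (by linarith) (by positivity)]
    nlinarith
  calc _ ≤ 1 / ((k:ℝ) + 1) * (2 / (k + 1)) := by
        apply mul_le_mul a1 a2 _ (by positivity)
        apply div_nonneg <;> linarith
    _ = _ := by push_cast; field_simp

lemma Mint (d : ℝ) (h0 : 0 ≤ d) (h1 : d < 1/2) :
    ∫⁻ b in Ioo (0:ℝ) 1, ∫⁻ t in Ioo (0:ℝ) 1,
      ENNReal.ofReal (b ^ (1 - 2 * d) * (1 - b * t) ^ (-d) * (1 - t) ^ (-d))
    = ENNReal.ofReal (1 / (2 * (1 - d) ^ 2) * F32 1 d (2-2*d) (2-d) (3-2*d)) := by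
  have hc : ∀ k : ℕ, 0 ≤ poch d k / (Nat.factorial k : ℝ) := fun k =>
    div_nonneg (poch_nonneg d h0 k) (by positivity)
  have e1 : ∀ b ∈ Ioo (0:ℝ) 1, ∫⁻ t in Ioo (0:ℝ) 1,
      ENNReal.ofReal (b ^ (1 - 2 * d) * (1 - b * t) ^ (-d) * (1 - t) ^ (-d))
      = ∑' k : ℕ, ENNReal.ofReal (poch d k / (Nat.factorial k : ℝ) * beta (k + 1) (1 - d))
          * ENNReal.ofReal (b ^ (1 - 2 * d + k)) := by
    intro b hb
    have e2 : ∀ t ∈ Ioo (0:ℝ) 1,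
      ENNReal.ofReal (b ^ (1 - 2 * d) * (1 - b * t) ^ (-d) * (1 - t) ^ (-d))
      = ∑' k : ℕ, ENNReal.ofReal (poch d k / (Nat.factorial k : ℝ) * b ^ (1 - 2 * d + k)) *
          ENNReal.ofReal (t ^ (k:ℝ) * (1 - t) ^ (-d)) := by
      intro t ht
      have hbt : b * t < 1 := by nlinarith [hb.1, hb.2, ht.1, ht.2]
      have hs := ((binom d (b * t) (mul_pos hb.1 ht.1).le hbt).mul_left
        (b ^ (1 - 2 * d))).mul_right ((1 - t) ^ (-d))
      have ht1 : 0 < 1 - t := by linarith [ht.2]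
      have hb0 := hb.1
      have ht0 := ht.1
      rw [← hs.tsum_eq, ENNReal.ofReal_tsum_of_nonneg _ hs.summable]
      · congr 1; ext k
        rw [← ENNReal.ofReal_mul (mul_nonneg (hc k) (by positivity)), rpow_add hb0, rpow_natCast,
          rpow_natCast, mul_pow]
        congr 1; ring
      · intro k
        have := hc k
        positivity
    rw [setLIntegral_congr_fun measurableSet_Ioo e2, lintegral_tsum]
    · congr 1; ext k
      rw [lintegral_const_mul' _ _ ENNReal.ofReal_ne_top,
        betaL k (-d) (by linarith [(k.cast_nonneg : (0:ℝ) ≤ k)]) (by linarith),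
        show -d + 1 = 1 - d by ring]
      have := beta_pos (α := k + 1) (β := 1 - d) (by positivity) (by linarith)
      have := hb.1
      rw [← ENNReal.ofReal_mul (mul_nonneg (hc k) (by positivity)),
        ← ENNReal.ofReal_mul (mul_nonneg (hc k) (by positivity))]
      congr 1; ring
    · intro k
      exact Measurable.aemeasurable (by fun_prop)
  rw [setLIntegral_congr_fun measurableSet_Ioo e1, lintegral_tsum]
  · have : 1 / (2 * (1 - d) ^ 2) * F32 1 d (2-2*d) (2-d) (3-2*d)
        = ∑' k, 1 / (2 * (1 - d) ^ 2) * tm d k := by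
      rw [tsum_mul_left]; rfl
    rw [this, ENNReal.ofReal_tsum_of_nonneg _ ((tm_summable d h0 h1).mul_left _)]
    · congr 1; ext k
      have hk : (0:ℝ) ≤ k := k.cast_nonneg
      have hbp := beta_pos (α := k + 1) (β := 1 - d) (by positivity) (by linarith)
      rw [lintegral_const_mul' _ _ ENNReal.ofReal_ne_top, powL _ (by linarith),
        ← ENNReal.ofReal_mul (mul_nonneg (hc k) hbp.le), tm_eq d h0 h1, beta_poch _ (by linarith)]
      rw [show 1 - d + 1 = 2 - d by ring]
      congr 1
      have := poch_pos (2 - d) (by linarith) k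
      have : (0:ℝ) < Nat.factorial k := by positivity
      have : 0 < 1 - d := by linarith
      have : 0 < 2 - 2 * d + k := by linarith
      rw [show 1 - 2 * d + k + 1 = 2 - 2 * d + k by ring, show 2 - 2 * d = 2 * (1 - d) by ring] 
      rw [show 2 - 2 * d = 2 * (1 - d) by ring] at this
      field_simp
    · intro k
      have := tm_nonneg d h0 h1 k
      positivity
  · intro k
    exact Measurable.aemeasurable (by fun_prop)

lemma inner1 (d : ℝ) (h0 : 0 ≤ d) (h1 : d < 1/2) (c y2 : ℝ) (h : c < y2) :
    ∫⁻ y3 in Ioo c y2, ∫⁻ y4 in Ioo c y3,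
      ENNReal.ofReal ((y2-y4)^(-d)*(y3-y4)^(-d)*(y3-c)^(-d))
    = ENNReal.ofReal ((y2 - c) ^ (2 - 3 * d)) *
      ENNReal.ofReal (1 / (2 * (1 - d) ^ 2) * F32 1 d (2-2*d) (2-d) (3-2*d)) := by
  rw [← Mint d h0 h1, aff c y2 h]
  have hr : 0 < y2 - c := by linarith
  have hr2 : (y2 - c) ^ (2 - 3 * d)
      = (y2 - c) * ((y2 - c) * ((y2 - c) ^ (-d) * (y2 - c) ^ (-d) * (y2 - c) ^ (-d))) := by
    rw [show 2 - 3 * d = 1 + (1 + ((-d) + (-d) + (-d))) by ring, rpow_add hr, rpow_add hr,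
      rpow_add hr, rpow_add hr, rpow_one]
  rw [hr2, ENNReal.ofReal_mul hr.le, mul_assoc,
    ← lintegral_const_mul' (ENNReal.ofReal ((y2 - c) * _)) _ ENNReal.ofReal_ne_top]
  congr 1
  refine setLIntegral_congr_fun measurableSet_Ioo (fun b hb => ?_)
  have hb0 := hb.1
  beta_reduce
  rw [aff c (c + (y2 - c) * b) (by nlinarith [hb.1]),
    ← lintegral_const_mul' _ _ ENNReal.ofReal_ne_top,
    ← lintegral_const_mul' _ _ ENNReal.ofReal_ne_top]
  refine setLIntegral_congr_fun measurableSet_Ioo (fun t ht => ?_)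
  have hbt : b * t < 1 := by nlinarith [hb.1, hb.2, ht.1, ht.2]
  have ht1 : 0 < 1 - t := by linarith [ht.2]
  have hbt1 : 0 < 1 - b * t := by linarith
  beta_reduce
  rw [show c + (y2 - c) * b - c = (y2 - c) * b by ring,
    show y2 - (c + (y2 - c) * b * t) = (y2 - c) * (1 - b * t) by ring,
    show c + (y2 - c) * b - (c + (y2 - c) * b * t) = (y2 - c) * (b * (1 - t)) by ring]
  rw [← ENNReal.ofReal_mul (by positivity), ← ENNReal.ofReal_mul (by positivity)]
  congr 1
  have hb2 : b ^ (1 - 2 * d) = b * (b ^ (-d) * b ^ (-d)) := by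
    rw [← rpow_add hb0, ← rpow_one_add' hb0.le]
    · congr 1; ring
    · linarith
  rw [mul_rpow hr.le hbt1.le, mul_rpow hr.le (by positivity), mul_rpow hr.le hb0.le,
    mul_rpow hb0.le ht1.le, hb2]
  ring

lemma inner2 (d : ℝ) (h0 : 0 ≤ d) (h1 : d < 1/2) (c y1 : ℝ) (h : c < y1) :
    ∫⁻ y2 in Ioo c y1, ENNReal.ofReal ((y1-y2)^(-d) * (y2-c)^(2-3*d))
    = ENNReal.ofReal ((y1 - c) ^ (3 - 4 * d) * beta (3 - 3 * d) (1 - d)) := by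
  have hr : 0 < y1 - c := by linarith
  rw [aff c y1 h]
  have e : ∀ t ∈ Ioo (0:ℝ) 1, ENNReal.ofReal ((y1-(c + (y1 - c) * t))^(-d) *
      ((c + (y1 - c) * t)-c)^(2-3*d)) =
      ENNReal.ofReal ((y1 - c) ^ (2 - 4 * d)) * ENNReal.ofReal (t ^ (2 - 3 * d) * (1 - t) ^ (-d)) := by
    intro t ht
    have ht1 : 0 < 1 - t := by linarith [ht.2]
    rw [show y1-(c + (y1 - c) * t) = (y1 - c) * (1 - t) by ring,
      show (c + (y1 - c) * t)-c = (y1 - c) * t by ring, mul_rpow hr.le ht1.le,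
      mul_rpow hr.le ht.1.le, show 2 - 4 * d = (-d) + (2 - 3 * d) by ring, rpow_add hr,
      ← ENNReal.ofReal_mul (by positivity)]
    congr 1; ring
  rw [setLIntegral_congr_fun measurableSet_Ioo e, lintegral_const_mul' _ _ ENNReal.ofReal_ne_top,
    betaL _ _ (by linarith) (by linarith), ← mul_assoc, ← ENNReal.ofReal_mul (by positivity),
    ← ENNReal.ofReal_mul (by positivity), ← rpow_one_add' hr.le (by linarith)]
  rw [show 1 + (2 - 4 * d) = 3 - 4 * d by ring, show 2 - 3 * d + 1 = 3 - 3 * d by ring,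
    show -d + 1 = 1 - d by ring]

lemma inner3 (d : ℝ) (h1 : d < 1/2) (c : ℝ) (h : c < 1) :
    ∫⁻ y1 in Ioo c 1, ENNReal.ofReal ((y1-c)^(3-5*d))
    = ENNReal.ofReal ((1 - c) ^ (4 - 5 * d) * (1 / (4 - 5 * d))) := by
  have hr : 0 < 1 - c := by linarith
  rw [aff c 1 h]
  have e : ∀ t ∈ Ioo (0:ℝ) 1, ENNReal.ofReal (((c + (1 - c) * t)-c)^(3-5*d)) =
      ENNReal.ofReal ((1 - c) ^ (3 - 5 * d)) * ENNReal.ofReal (t ^ (3 - 5 * d)) := by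
    intro t ht
    rw [show (c + (1 - c) * t)-c = (1 - c) * t by ring, mul_rpow hr.le ht.1.le,
      ← ENNReal.ofReal_mul (by positivity)]
  rw [setLIntegral_congr_fun measurableSet_Ioo e, lintegral_const_mul' _ _ ENNReal.ofReal_ne_top,
    powL _ (by linarith), ← mul_assoc, ← ENNReal.ofReal_mul (by positivity),
    ← ENNReal.ofReal_mul (by positivity), ← rpow_one_add' hr.le (by linarith)]
  congr 3 <;> ring

noncomputable def FF (d y1 y2 y3 y4 y5 : ℝ) : ENNReal := ENNReal.ofReal
  ((y1 - y2) ^ (-d) * (y2 - y4) ^ (-d) * (y3 - y4) ^ (-d) * (y3 - y5) ^ (-d) * (y1 - y5) ^ (-d))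

lemma ordered (d : ℝ) (h0 : 0 ≤ d) (h1 : d < 1/2) :
    ∫⁻ c in Ioo (0:ℝ) 1, ∫⁻ y1 in Ioo c 1, ∫⁻ y2 in Ioo c y1, ∫⁻ y3 in Ioo c y2, ∫⁻ y4 in Ioo c y3,
      FF d y1 y2 y3 y4 c = ENNReal.ofReal (1 / (5 - 5 * d) * (1 / (4 - 5 * d)) *
        beta (3 - 3 * d) (1 - d) * (1 / (2 * (1 - d) ^ 2) * F32 1 d (2-2*d) (2-d) (3-2*d))) := by
  obtain ⟨K, hK⟩ : ∃ K, K = 1 / (2 * (1 - d) ^ 2) * F32 1 d (2-2*d) (2-d) (3-2*d) := ⟨_, rfl⟩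
  rw [← hK]
  have hB := beta_pos (α := 3 - 3 * d) (β := 1 - d) (by linarith) (by linarith)
  have s1 : ∀ c ∈ Ioo (0:ℝ) 1, ∀ y1 ∈ Ioo c 1, ∀ y2 ∈ Ioo c y1,
      ∫⁻ y3 in Ioo c y2, ∫⁻ y4 in Ioo c y3, FF d y1 y2 y3 y4 c
      = ENNReal.ofReal ((y1 - c) ^ (-d)) * ENNReal.ofReal K *
         ENNReal.ofReal ((y1-y2)^(-d) * (y2-c)^(2-3*d)) := by
    intro c hc y1 hy1 y2 hy2
    have p1 : 0 < y1 - y2 := by linarith [hy2.2]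
    have p2 : 0 < y1 - c := by linarith [hy1.1]
    have p3 : 0 < y2 - c := by linarith [hy2.1]
    have : ∀ y3 y4, FF d y1 y2 y3 y4 c = ENNReal.ofReal ((y1-y2)^(-d) * (y1 - c)^(-d)) *
        ENNReal.ofReal ((y2-y4)^(-d)*(y3-y4)^(-d)*(y3-c)^(-d)) := by
      intro y3 y4
      rw [FF, ← ENNReal.ofReal_mul (by positivity)]
      congr 1; ring
    simp_rw [this]
    simp_rw [lintegral_const_mul' _ _ ENNReal.ofReal_ne_top]
    rw [inner1 d h0 h1 c y2 hy2.1, ← hK, ENNReal.ofReal_mul (rpow_nonneg p1.le (-d)),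
      ENNReal.ofReal_mul (rpow_nonneg p1.le (-d))]
    ring
  have s2 : ∀ c ∈ Ioo (0:ℝ) 1, ∀ y1 ∈ Ioo c 1, 
      ∫⁻ y2 in Ioo c y1, ∫⁻ y3 in Ioo c y2, ∫⁻ y4 in Ioo c y3, FF d y1 y2 y3 y4 c
      = ENNReal.ofReal K * ENNReal.ofReal (beta (3 - 3 * d) (1 - d)) *
          ENNReal.ofReal ((y1 - c) ^ (3 - 5 * d)) := by
    intro c hc y1 hy1
    have p2 : 0 < y1 - c := by linarith [hy1.1]
    rw [setLIntegral_congr_fun measurableSet_Ioo (s1 c hc y1 hy1),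
      lintegral_const_mul' _ _ (ENNReal.mul_ne_top ENNReal.ofReal_ne_top ENNReal.ofReal_ne_top),
      inner2 d h0 h1 c y1 hy1.1, show 3 - 5 * d = -d + (3 - 4 * d) by ring, rpow_add p2,
      ENNReal.ofReal_mul (rpow_nonneg p2.le (-d)),
      ENNReal.ofReal_mul (rpow_nonneg p2.le (3 - 4 * d))]
    ring
  have s3 : ∀ c ∈ Ioo (0:ℝ) 1, 
      ∫⁻ y1 in Ioo c 1, ∫⁻ y2 in Ioo c y1, ∫⁻ y3 in Ioo c y2, ∫⁻ y4 in Ioo c y3, FF d y1 y2 y3 y4 c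
      = ENNReal.ofReal K * ENNReal.ofReal (beta (3 - 3 * d) (1 - d)) *
        ENNReal.ofReal (1 / (4 - 5 * d)) * ENNReal.ofReal ((1 - c) ^ (4 - 5 * d)) := by
    intro c hc
    have p2 : 0 < 1 - c := by linarith [hc.2]
    rw [setLIntegral_congr_fun measurableSet_Ioo (s2 c hc),
      lintegral_const_mul' _ _ (ENNReal.mul_ne_top ENNReal.ofReal_ne_top ENNReal.ofReal_ne_top),
      inner3 d h1 c hc.2, ENNReal.ofReal_mul (rpow_nonneg p2.le (4 - 5 * d))]
    ring
  have p4 : 0 < 1 / (4 - 5 * d) := one_div_pos.2 (by linarith)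
  have p5 : 0 < 1 / (5 - 5 * d) := one_div_pos.2 (by linarith)
  rw [setLIntegral_congr_fun measurableSet_Ioo s3,
      lintegral_const_mul' _ _ (ENNReal.mul_ne_top (ENNReal.mul_ne_top ENNReal.ofReal_ne_top
        ENNReal.ofReal_ne_top) ENNReal.ofReal_ne_top), powL' _ (by linarith),
      show 4 - 5 * d + 1 = 5 - 5 * d by ring, ENNReal.ofReal_mul (mul_pos (mul_pos p5 p4) hB).le,
      ENNReal.ofReal_mul (mul_pos p5 p4).le, ENNReal.ofReal_mul p5.le]
  ring

lemma FF_meas {α : Type*} [MeasurableSpace α] (d : ℝ) (a b c e f : α → ℝ) (ha : Measurable a)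
    (hb : Measurable b) (hc : Measurable c) (he : Measurable e) (hf : Measurable f) :
    Measurable (fun x => FF d (a x) (b x) (c x) (e x) (f x)) := by
  unfold FF
  fun_prop

lemma reorder (d : ℝ) :
    ∫⁻ y1 in Ioo (0:ℝ) 1, ∫⁻ y2 in Ioo 0 y1, ∫⁻ y3 in Ioo 0 y2, ∫⁻ y4 in Ioo 0 y3, ∫⁻ c in Ioo 0 y4,
      FF d y1 y2 y3 y4 c =
    ∫⁻ c in Ioo (0:ℝ) 1, ∫⁻ y1 in Ioo c 1, ∫⁻ y2 in Ioo c y1, ∫⁻ y3 in Ioo c y2, ∫⁻ y4 in Ioo c y3,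
      FF d y1 y2 y3 y4 c := by
  have t1 : ∀ y1 y2 y3, ∫⁻ y4 in Ioo 0 y3, ∫⁻ c in Ioo 0 y4, FF d y1 y2 y3 y4 c =
      ∫⁻ c in Ioo 0 y3, ∫⁻ y4 in Ioo c y3, FF d y1 y2 y3 y4 c := by
    intro y1 y2 y3
    apply tri y3 (fun y4 c => FF d y1 y2 y3 y4 c)
    apply FF_meas <;> fun_prop
  have t2 : ∀ y1 y2, ∫⁻ y3 in Ioo 0 y2, ∫⁻ c in Ioo 0 y3, ∫⁻ y4 in Ioo c y3, FF d y1 y2 y3 y4 c =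
      ∫⁻ c in Ioo 0 y2, ∫⁻ y3 in Ioo c y2, ∫⁻ y4 in Ioo c y3, FF d y1 y2 y3 y4 c := by
    intro y1 y2
    apply tri y2 (fun y3 c => ∫⁻ y4 in Ioo c y3, FF d y1 y2 y3 y4 c)
    apply meas_Ioo (fun p : ℝ × ℝ => p.2) (fun p => p.1) (by fun_prop) (by fun_prop)
      (fun p y4 => FF d y1 y2 p.1 y4 p.2)
    apply FF_meas <;> fun_prop
  have t3 : ∀ y1, ∫⁻ y2 in Ioo 0 y1, ∫⁻ c in Ioo 0 y2, ∫⁻ y3 in Ioo c y2, ∫⁻ y4 in Ioo c y3,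
      FF d y1 y2 y3 y4 c =
      ∫⁻ c in Ioo 0 y1, ∫⁻ y2 in Ioo c y1, ∫⁻ y3 in Ioo c y2, ∫⁻ y4 in Ioo c y3,
        FF d y1 y2 y3 y4 c := by
    intro y1
    apply tri y1 (fun y2 c => ∫⁻ y3 in Ioo c y2, ∫⁻ y4 in Ioo c y3, FF d y1 y2 y3 y4 c)
    apply meas_Ioo (fun p : ℝ × ℝ => p.2) (fun p => p.1) (by fun_prop) (by fun_prop)
      (fun p y3 => ∫⁻ y4 in Ioo p.2 y3, FF d y1 p.1 y3 y4 p.2)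
    apply meas_Ioo (fun p : (ℝ × ℝ) × ℝ => p.1.2) (fun p => p.2) (by fun_prop) (by fun_prop)
      (fun p y4 => FF d y1 p.1.1 p.2 y4 p.1.2)
    apply FF_meas <;> fun_prop
  simp_rw [t1, t2, t3]
  apply tri 1 (fun y1 c => ∫⁻ y2 in Ioo c y1, ∫⁻ y3 in Ioo c y2, ∫⁻ y4 in Ioo c y3,
    FF d y1 y2 y3 y4 c)
  apply meas_Ioo (fun p : ℝ × ℝ => p.2) (fun p => p.1) (by fun_prop) (by fun_prop)
      (fun p y2 => ∫⁻ y3 in Ioo p.2 y2, ∫⁻ y4 in Ioo p.2 y3, FF d p.1 y2 y3 y4 p.2)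
  apply meas_Ioo (fun p : (ℝ × ℝ) × ℝ => p.1.2) (fun p => p.2) (by fun_prop) (by fun_prop)
      (fun p y3 => ∫⁻ y4 in Ioo p.1.2 y3, FF d p.1.1 p.2 y3 y4 p.1.2)
  apply meas_Ioo (fun p : ((ℝ × ℝ) × ℝ) × ℝ => p.1.1.2) (fun p => p.2) (by fun_prop) (by fun_prop)
      (fun p y4 => FF d p.1.1.1 p.1.2 p.2 y4 p.1.1.2)
  apply FF_meas <;> fun_prop

lemma m5 {α : Type*} [MeasurableSpace α] (d : ℝ) (a b c e : α → ℝ) (ha : Measurable a)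
    (hb : Measurable b) (hc : Measurable c) (he : Measurable e) :
    Measurable (fun x => ∫⁻ z in Ioo 0 (e x), FF d (a x) (b x) (c x) (e x) z) := by
  apply meas_Ioo (fun _ => 0) e measurable_const he
      (fun x z => FF d (a x) (b x) (c x) (e x) z)
  apply FF_meas <;> fun_prop

lemma m4 {α : Type*} [MeasurableSpace α] (d : ℝ) (a b c : α → ℝ) (ha : Measurable a)
    (hb : Measurable b) (hc : Measurable c) :
    Measurable (fun x => ∫⁻ y4 in Ioo 0 (c x), ∫⁻ z in Ioo 0 y4, FF d (a x) (b x) (c x) y4 z) := by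
  apply meas_Ioo (fun _ => 0) c measurable_const hc
      (fun x y4 => ∫⁻ z in Ioo 0 y4, FF d (a x) (b x) (c x) y4 z)
  apply m5 d (fun p : α × ℝ => a p.1) (fun p => b p.1) (fun p => c p.1) (fun p => p.2) <;> fun_prop

lemma m3 {α : Type*} [MeasurableSpace α] (d : ℝ) (a b : α → ℝ) (ha : Measurable a)
    (hb : Measurable b) :
    Measurable (fun x => ∫⁻ y3 in Ioo 0 (b x), ∫⁻ y4 in Ioo 0 y3, ∫⁻ z in Ioo 0 y4,
      FF d (a x) (b x) y3 y4 z) := by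
  apply meas_Ioo (fun _ => 0) b measurable_const hb
      (fun x y3 => ∫⁻ y4 in Ioo 0 y3, ∫⁻ z in Ioo 0 y4, FF d (a x) (b x) y3 y4 z)
  apply m4 d (fun p : α × ℝ => a p.1) (fun p => b p.1) (fun p => p.2) <;> fun_prop

lemma m2 {α : Type*} [MeasurableSpace α] (d : ℝ) (a : α → ℝ) (ha : Measurable a) :
    Measurable (fun x => ∫⁻ y2 in Ioo 0 (a x), ∫⁻ y3 in Ioo 0 y2, ∫⁻ y4 in Ioo 0 y3,
      ∫⁻ z in Ioo 0 y4, FF d (a x) y2 y3 y4 z) := by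
  apply meas_Ioo (fun _ => 0) a measurable_const ha
      (fun x y2 => ∫⁻ y3 in Ioo 0 y2, ∫⁻ y4 in Ioo 0 y3, ∫⁻ z in Ioo 0 y4, FF d (a x) y2 y3 y4 z)
  apply m3 d (fun p : α × ℝ => a p.1) (fun p => p.2) <;> fun_prop

theorem stmt9 (d : ℝ) (h0 : 0 ≤ d) (h1 : d < 1/2) :
    (∫ y1 in (0:ℝ)..1, ∫ y2 in (0:ℝ)..y1, ∫ y3 in (0:ℝ)..y2, ∫ y4 in (0:ℝ)..y3, ∫ y5 in (0:ℝ)..y4,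
      (y1 - y2) ^ (-d) * (y2 - y4) ^ (-d) * (y3 - y4) ^ (-d) * (y3 - y5) ^ (-d) * (y1 - y5) ^ (-d)) =
    Gamma (1-d) / (2 * (1-d) ^ 2) * (Gamma (3-3*d) * Gamma (4-5*d) / (Gamma (4-4*d) * Gamma (6-5*d))) *
      F32 1 d (2-2*d) (2-d) (3-2*d) := by
  have hL := (reorder d).trans (ordered d h0 h1)
  have hne : ∫⁻ y1 in Ioo (0:ℝ) 1, ∫⁻ y2 in Ioo 0 y1, ∫⁻ y3 in Ioo 0 y2, ∫⁻ y4 in Ioo 0 y3,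
      ∫⁻ c in Ioo 0 y4, FF d y1 y2 y3 y4 c ≠ ⊤ := by
    rw [hL]; exact ENNReal.ofReal_ne_top
  have key := stepL 1 zero_le_one _ (m2 d (fun y1 => y1) measurable_id)
    (fun y1 => ∫ y2 in (0:ℝ)..y1, ∫ y3 in (0:ℝ)..y2, ∫ y4 in (0:ℝ)..y3, ∫ y5 in (0:ℝ)..y4,
      (y1 - y2) ^ (-d) * (y2 - y4) ^ (-d) * (y3 - y4) ^ (-d) * (y3 - y5) ^ (-d) * (y1 - y5) ^ (-d))
    hne (by
      intro y1 hy1 f1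
      refine stepL y1 hy1.1.le _ (m3 d (fun _ => y1) (fun y2 => y2) measurable_const measurable_id)
        _ f1 ?_
      intro y2 hy2 f2
      refine stepL y2 hy2.1.le _ (m4 d (fun _ => y1) (fun _ => y2) (fun y3 => y3) measurable_const
        measurable_const measurable_id) _ f2 ?_
      intro y3 hy3 f3
      refine stepL y3 hy3.1.le _ (m5 d (fun _ => y1) (fun _ => y2) (fun _ => y3) (fun y4 => y4)
        measurable_const measurable_const measurable_const measurable_id) _ f3 ?_
      intro y4 hy4 f4
      refine stepL y4 hy4.1.le _ (FF_meas d (fun _ => y1) (fun _ => y2) (fun _ => y3) (fun _ => y4)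
        (fun c => c) measurable_const measurable_const measurable_const measurable_const
        measurable_id) _ f4 ?_
      intro y5 hy5 f5
      have p1 : 0 < y1 - y2 := by linarith [hy2.2]
      have p2 : 0 < y2 - y4 := by linarith [hy3.2, hy4.2]
      have p3 : 0 < y3 - y4 := by linarith [hy4.2]
      have p4 : 0 < y3 - y5 := by linarith [hy4.2, hy5.2]
      have p5 : 0 < y1 - y5 := by linarith [hy2.2, hy3.2, hy4.2, hy5.2]
      rw [FF, ENNReal.toReal_ofReal (by positivity)])
  rw [key, hL, ENNReal.toReal_ofReal]
  · have q1 := Gamma_pos_of_pos (show 0 < 4 - 5 * d by linarith)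
    have q2 := Gamma_pos_of_pos (show 0 < 4 - 4 * d by linarith)
    have r4 : 0 < 4 - 5 * d := by linarith
    have r5 : 0 < 5 - 5 * d := by linarith
    rw [beta, show 6 - 5 * d = (4 - 5 * d + 1) + 1 by ring, Gamma_add_one (by linarith),
      Gamma_add_one (by linarith), show 3 - 3 * d + (1 - d) = 4 - 4 * d by ring,
      show 4 - 5 * d + 1 = 5 - 5 * d by ring]
    field_simp
  · have hB := beta_pos (α := 3 - 3 * d) (β := 1 - d) (by linarith) (by linarith)
    have hF : 0 ≤ F32 1 d (2-2*d) (2-d) (3-2*d) := tsum_nonneg (tm_nonneg d h0 h1)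
    have p4 : 0 < 1 / (4 - 5 * d) := one_div_pos.2 (by linarith)
    have p5 : 0 < 1 / (5 - 5 * d) := one_div_pos.2 (by linarith)
    positivity
end
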